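/- There is no smooth Riemannian metric on 𝔹, i.e. no smooth assignment w ↦ m_w of a positive-definite symmetric ℝ-bilinear form on ℍ ≅ ℝ⁴ to each w ∈ 𝔹, which has as isometries: (i) every regular Möbius transformation φ_{a,u}(q) = ((1 − q̃·conj(a))⁻¹ (q̃ − a))·u with a ∈ 𝔹, u ∈ ℍ, ‖u‖ = 1, and q̃ = (1 − qa)⁻¹ q (1 − qa) (this is the pointwise formula for q ↦ ((1 − q·conj(a))^{−∗} ∗ (q − a))·u), i.e. m_{φ(w)}(Dφ[w](d), Dφ[w](d)) = m_w(d, d) for all w ∈ 𝔹 and d ∈ ℍ, where Dφ[w] is the Fréchet derivative of φ at w; and (ii) every map T_A(q) = Re(q) + A(Im(q)) with A an orthogonal transformation of the 3-space of imaginary quaternions, with the same invariance condition. -/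

import Mathlib

noncomputable section

open Set

local notation "ℍ" => Quaternion ℝ

/-- The open unit ball `𝔹` in the quaternions. -/
def Ball : Set ℍ := {q | ‖q‖ < 1}

/-- The regular Möbius transformation `φ_{a,u}(q) = ((1 − q̃·conj(a))⁻¹ (q̃ − a))·u`
with `q̃ = (1 − qa)⁻¹ q (1 − qa)`; this is the pointwise formula for
`q ↦ ((1 − q·conj(a))^{−∗} ∗ (q − a))·u`. -/
def regMob (a u : ℍ) (q : ℍ) : ℍ :=
  ((1 - ((1 - q * a)⁻¹ * q * (1 - q * a)) * star a)⁻¹ *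
    (((1 - q * a)⁻¹ * q * (1 - q * a)) - a)) * u

lemma inv_line {g : ℝ → ℍ} {g' : ℍ} (hg : HasDerivAt g g' 0) (h0 : g 0 ≠ 0) :
    HasDerivAt (fun t => (g t)⁻¹) (-((g 0)⁻¹ * g' * (g 0)⁻¹)) 0 := by
  have h := (hasFDerivAt_inv' (𝕜 := ℝ) h0).comp_hasDerivAt (0 : ℝ) hg
  simpa [Function.comp_def] using h

lemma fderiv_regMob (a u d : ℍ) (hP : 1 - a * a ≠ 0) (hN : 1 - a * star a ≠ 0) :
    regMob a u a = 0 ∧ fderiv ℝ (regMob a u) a d = ((1 - a * star a)⁻¹ *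
      ((1 - a * a)⁻¹ * (d * a) * (1 - a * a)⁻¹ * a * (1 - a * a) +
        (1 - a * a)⁻¹ * d * (1 - a * a) - (1 - a * a)⁻¹ * a * (d * a))) * u := by
  have hc : (1 - a * a)⁻¹ * a * (1 - a * a) = a := by
    rw [mul_assoc, show a * (1 - a * a) = (1 - a * a) * a by noncomm_ring,
      inv_mul_cancel_left₀ hP]
  have hN2 : 1 - ((1 - a * a)⁻¹ * a * (1 - a * a)) * star a ≠ 0 := by rwa [hc]
  refine ⟨by simp [regMob, hc], ?_⟩
  have hd : DifferentiableAt ℝ (regMob a u) a := by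
    unfold regMob
    fun_prop (disch := assumption)
  have hl : HasDerivAt (fun t : ℝ => a + t • d) d 0 := by
    simpa using ((hasDerivAt_id (0 : ℝ)).smul_const d).const_add a
  have h1 := hd.hasFDerivAt.comp_hasDerivAt_of_eq (0 : ℝ) hl (by simp)
  have hp : HasDerivAt (fun t : ℝ => 1 - (a + t • d) * a) (-(d * a)) 0 :=
    (hl.mul_const a).const_sub 1
  have hpi := inv_line hp (by simpa using hP)
  have hq := (hpi.fun_mul hl).fun_mul hp
  have hn := inv_line ((hq.mul_const (star a)).const_sub 1) (by simpa using hN2)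
  have hf := ((hn.fun_mul (hq.sub_const a)).mul_const u)
  have h2 := h1.unique hf
  rw [h2]
  simp only [zero_smul, add_zero, hc, sub_self, mul_zero, zero_add]
  congr 2
  simp only [mul_neg, neg_mul, neg_neg, add_mul, sub_eq_add_neg]

lemma fderiv_regMob_real (a d : ℍ) (c n : ℝ) (hc0 : c ≠ 0) (hn0 : n ≠ 0)
    (hP : 1 - a * a = (c : ℍ)) (hN : 1 - a * star a = (n : ℍ)) :
    regMob a 1 a = 0 ∧ fderiv ℝ (regMob a 1) a d =
      n⁻¹ • (c⁻¹ • (d * a * a - a * (d * a)) + d) := by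
  have nz : ∀ r : ℝ, r ≠ 0 → (r : ℍ) ≠ 0 := fun r hr h =>
    hr (Quaternion.coe_injective (h.trans Quaternion.coe_zero.symm))
  have h := fderiv_regMob a 1 d (hP ▸ nz c hc0) (hN ▸ nz n hn0)
  refine ⟨h.1, ?_⟩
  rw [h.2, hP, hN, ← Quaternion.coe_inv, ← Quaternion.coe_inv, mul_one]
  simp only [Quaternion.coe_mul_eq_smul, Quaternion.mul_coe_eq_smul, smul_mul_assoc, smul_smul,
    ← mul_assoc]
  match_scalars <;> field_simp

lemma fderiv_regMob_zero (u w d : ℍ) :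
    regMob 0 u w = w * u ∧ fderiv ℝ (regMob 0 u) w d = d * u := by
  have h : regMob 0 u = fun q => q * u := by
    ext1 q; simp [regMob]
  rw [h]
  refine ⟨rfl, ?_⟩
  have := ((ContinuousLinearMap.mul ℝ ℍ).flip u).hasFDerivAt (x := w)
  have h3 := this.fderiv
  have h4 : (⇑((ContinuousLinearMap.mul ℝ ℍ).flip u)) = fun q => q * u := by
    ext1 q; simp
  rw [h4] at h3
  rw [h3]; simp

lemma norm_of_normSq {q : ℍ} {r : ℝ} (hr : 0 ≤ r) (h : Quaternion.normSq q = r * r) :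
    ‖q‖ = r := by
  rw [Quaternion.normSq_eq_norm_mul_self] at h
  nlinarith [norm_nonneg q, mul_self_inj (norm_nonneg q) hr |>.1 h]

/-- There is no smooth Riemannian metric on `𝔹` (a smooth assignment `w ↦ m_w` of a
positive-definite symmetric `ℝ`-bilinear form on `ℍ ≅ ℝ⁴`) having as isometries (i)
every regular Möbius transformation `φ_{a,u}` with `a ∈ 𝔹` and `‖u‖ = 1`, and (ii)
every map `T_A(q) = Re(q) + A(Im(q))` with `A` an orthogonal transformation of the
3-space of imaginary quaternions (encoded as a linear isometry of `ℍ` fixing `1` and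
preserving the imaginary subspace). -/
theorem no_invariant_riemannian_metric :
    ¬ ∃ m : ℍ → ℍ → ℍ → ℝ,
      (∀ d e : ℍ, ContDiffOn ℝ (⊤ : ℕ∞) (fun w => m w d e) Ball) ∧
      (∀ w ∈ Ball, ∀ d e : ℍ, m w d e = m w e d) ∧
      (∀ w ∈ Ball, ∀ d : ℍ, IsLinearMap ℝ (fun e => m w d e)) ∧
      (∀ w ∈ Ball, ∀ d : ℍ, d ≠ 0 → 0 < m w d d) ∧
      (∀ a ∈ Ball, ∀ u : ℍ, ‖u‖ = 1 → ∀ w ∈ Ball, ∀ d : ℍ,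
        m (regMob a u w) (fderiv ℝ (regMob a u) w d) (fderiv ℝ (regMob a u) w d) =
          m w d d) ∧
      (∀ A : ℍ ≃ₗᵢ[ℝ] ℍ, A 1 = 1 → (∀ q : ℍ, q.re = 0 → (A q).re = 0) →
        ∀ w ∈ Ball, ∀ d : ℍ, m (A w) (A d) (A d) = m w d d) := by
  rintro ⟨m, -, hsym, hlin, hpos, hmob, -⟩
  have h0 : (0 : ℍ) ∈ Ball := by simp [Ball]
  -- imaginary units
  obtain ⟨I, I0, I1, I2, I3⟩ : ∃ q : ℍ, q.re = 0 ∧ q.imI = 1 ∧ q.imJ = 0 ∧ q.imK = 0 :=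
    ⟨⟨0, 1, 0, 0⟩, rfl, rfl, rfl, rfl⟩
  obtain ⟨J, J0, J1, J2, J3⟩ : ∃ q : ℍ, q.re = 0 ∧ q.imI = 0 ∧ q.imJ = 1 ∧ q.imK = 0 :=
    ⟨⟨0, 0, 1, 0⟩, rfl, rfl, rfl, rfl⟩
  obtain ⟨K, K0, K1, K2, K3⟩ : ∃ q : ℍ, q.re = 0 ∧ q.imI = 0 ∧ q.imJ = 0 ∧ q.imK = 1 :=
    ⟨⟨0, 0, 0, 1⟩, rfl, rfl, rfl, rfl⟩
  obtain ⟨a, a0, a1, a2, a3⟩ : ∃ q : ℍ, q.re = 1/2 ∧ q.imI = 0 ∧ q.imJ = 0 ∧ q.imK = 0 :=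
    ⟨⟨1/2, 0, 0, 0⟩, rfl, rfl, rfl, rfl⟩
  obtain ⟨b, b0, b1, b2, b3⟩ : ∃ q : ℍ, q.re = 0 ∧ q.imI = 1/2 ∧ q.imJ = 0 ∧ q.imK = 0 :=
    ⟨⟨0, 1/2, 0, 0⟩, rfl, rfl, rfl, rfl⟩
  have hI : ‖I‖ = 1 := norm_of_normSq (by norm_num) (by simp [Quaternion.normSq_def', I0, I1, I2, I3])
  have ha : a ∈ Ball := by
    have : ‖a‖ = 1/2 := norm_of_normSq (by norm_num)
      (by simp [Quaternion.normSq_def', a0, a1, a2, a3]; norm_num)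
    change ‖a‖ < 1; rw [this]; norm_num
  have hb : b ∈ Ball := by
    have : ‖b‖ = 1/2 := norm_of_normSq (by norm_num)
      (by simp [Quaternion.normSq_def', b0, b1, b2, b3]; norm_num)
    change ‖b‖ < 1; rw [this]; norm_num
  have right : ∀ w ∈ Ball, ∀ d, m (w * I) (d * I) (d * I) = m w d d := by
    intro w hw d
    have := hmob 0 h0 I hI w hw d
    rwa [(fderiv_regMob_zero I w d).1, (fderiv_regMob_zero I w d).2] at this
  have hab : a * I = b := by ext <;> simp only [
      Quaternion.re_mul, Quaternion.re_sub, Quaternion.re_add, Quaternion.re_neg, Quaternion.re_one, Quaternion.re_star, Quaternion.re_coe, Quaternion.re_smul, Quaternion.imI_mul, Quaternion.imI_sub, Quaternion.imI_add, Quaternion.imI_neg, Quaternion.imI_one, Quaternion.imI_star, Quaternion.imI_coe, Quaternion.imI_smul, Quaternion.imJ_mul, Quaternion.imJ_sub, Quaternion.imJ_add, Quaternion.imJ_neg, Quaternion.imJ_one, Quaternion.imJ_star, Quaternion.imJ_coe, Quaternion.imJ_smul, Quaternion.imK_mul, Quaternion.imK_sub, Quaternion.imK_add, Quaternion.imK_neg,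 Quaternion.imK_one, Quaternion.imK_star, Quaternion.imK_coe, Quaternion.imK_smul, smul_eq_mul, a0, a1, a2, a3, b0, b1, b2, b3, I0, I1, I2, I3] <;> norm_num
  have hJI : J * I = -K := by ext <;> simp only [
      Quaternion.re_mul, Quaternion.re_sub, Quaternion.re_add, Quaternion.re_neg, Quaternion.re_one, Quaternion.re_star, Quaternion.re_coe, Quaternion.re_smul, Quaternion.imI_mul, Quaternion.imI_sub, Quaternion.imI_add, Quaternion.imI_neg, Quaternion.imI_one, Quaternion.imI_star, Quaternion.imI_coe, Quaternion.imI_smul, Quaternion.imJ_mul, Quaternion.imJ_sub, Quaternion.imJ_add, Quaternion.imJ_neg, Quaternion.imJ_one, Quaternion.imJ_star, Quaternion.imJ_coe, Quaternion.imJ_smul, Quaternion.imK_mul, Quaternion.imK_sub, Quaternion.imK_add, Quaternion.imK_neg, Quaternion.imK_one, Quaternion.imK_star, Quaternion.imK_coe, Quaternion.imK_smul, smul_eq_mul, J0, J1, J2, J3, K0, K1, K2, K3, I0, I1, I2, I3] <;> norm_num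
  have aa : 1 - a * a = ((3/4 : ℝ) : ℍ) := by ext <;> simp only [
      Quaternion.re_mul, Quaternion.re_sub, Quaternion.re_add, Quaternion.re_neg, Quaternion.re_one, Quaternion.re_star, Quaternion.re_coe, Quaternion.re_smul, Quaternion.imI_mul, Quaternion.imI_sub, Quaternion.imI_add, Quaternion.imI_neg, Quaternion.imI_one, Quaternion.imI_star, Quaternion.imI_coe, Quaternion.imI_smul, Quaternion.imJ_mul, Quaternion.imJ_sub, Quaternion.imJ_add, Quaternion.imJ_neg, Quaternion.imJ_one, Quaternion.imJ_star, Quaternion.imJ_coe, Quaternion.imJ_smul, Quaternion.imK_mul, Quaternion.imK_sub, Quaternion.imK_add, Quaternion.imK_neg, Quaternion.imK_one, Quaternion.imK_star, Quaternion.imK_coe, Quaternion.imK_smul, smul_eq_mul, a0, a1, a2, a3] <;> norm_num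
  have aS : 1 - a * star a = ((3/4 : ℝ) : ℍ) := by ext <;> simp only [
      Quaternion.re_mul, Quaternion.re_sub, Quaternion.re_add, Quaternion.re_neg, Quaternion.re_one, Quaternion.re_star, Quaternion.re_coe, Quaternion.re_smul, Quaternion.imI_mul, Quaternion.imI_sub, Quaternion.imI_add, Quaternion.imI_neg, Quaternion.imI_one, Quaternion.imI_star, Quaternion.imI_coe, Quaternion.imI_smul, Quaternion.imJ_mul, Quaternion.imJ_sub, Quaternion.imJ_add, Quaternion.imJ_neg, Quaternion.imJ_one, Quaternion.imJ_star, Quaternion.imJ_coe, Quaternion.imJ_smul, Quaternion.imK_mul, Quaternion.imK_sub, Quaternion.imK_add, Quaternion.imK_neg, Quaternion.imK_one, Quaternion.imK_star, Quaternion.imK_coe, Quaternion.imK_smul, smul_eq_mul, a0, a1, a2, a3] <;> norm_num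
  have bb : 1 - b * b = ((5/4 : ℝ) : ℍ) := by ext <;> simp only [
      Quaternion.re_mul, Quaternion.re_sub, Quaternion.re_add, Quaternion.re_neg, Quaternion.re_one, Quaternion.re_star, Quaternion.re_coe, Quaternion.re_smul, Quaternion.imI_mul, Quaternion.imI_sub, Quaternion.imI_add, Quaternion.imI_neg, Quaternion.imI_one, Quaternion.imI_star, Quaternion.imI_coe, Quaternion.imI_smul, Quaternion.imJ_mul, Quaternion.imJ_sub, Quaternion.imJ_add, Quaternion.imJ_neg, Quaternion.imJ_one, Quaternion.imJ_star, Quaternion.imJ_coe, Quaternion.imJ_smul, Quaternion.imK_mul, Quaternion.imK_sub, Quaternion.imK_add, Quaternion.imK_neg, Quaternion.imK_one, Quaternion.imK_star, Quaternion.imK_coe, Quaternion.imK_smul, smul_eq_mul, b0, b1, b2, b3] <;> norm_num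
  have bS : 1 - b * star b = ((3/4 : ℝ) : ℍ) := by ext <;> simp only [
      Quaternion.re_mul, Quaternion.re_sub, Quaternion.re_add, Quaternion.re_neg, Quaternion.re_one, Quaternion.re_star, Quaternion.re_coe, Quaternion.re_smul, Quaternion.imI_mul, Quaternion.imI_sub, Quaternion.imI_add, Quaternion.imI_neg, Quaternion.imI_one, Quaternion.imI_star, Quaternion.imI_coe, Quaternion.imI_smul, Quaternion.imJ_mul, Quaternion.imJ_sub, Quaternion.imJ_add, Quaternion.imJ_neg, Quaternion.imJ_one, Quaternion.imJ_star, Quaternion.imJ_coe, Quaternion.imJ_smul, Quaternion.imK_mul, Quaternion.imK_sub, Quaternion.imK_add, Quaternion.imK_neg, Quaternion.imK_one, Quaternion.imK_star, Quaternion.imK_coe, Quaternion.imK_smul, smul_eq_mul, b0, b1, b2, b3] <;> norm_num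
  have dA := fderiv_regMob_real a J _ _ (by norm_num) (by norm_num) aa aS
  have dB := fderiv_regMob_real b (-K) _ _ (by norm_num) (by norm_num) bb bS
  have eA : fderiv ℝ (regMob a 1) a J = (4/3 : ℝ) • J := by
    rw [dA.2]
    ext <;> simp only [
      Quaternion.re_mul, Quaternion.re_sub, Quaternion.re_add, Quaternion.re_neg, Quaternion.re_one, Quaternion.re_star, Quaternion.re_coe, Quaternion.re_smul, Quaternion.imI_mul, Quaternion.imI_sub, Quaternion.imI_add, Quaternion.imI_neg, Quaternion.imI_one, Quaternion.imI_star, Quaternion.imI_coe, Quaternion.imI_smul, Quaternion.imJ_mul, Quaternion.imJ_sub, Quaternion.imJ_add, Quaternion.imJ_neg, Quaternion.imJ_one, Quaternion.imJ_star, Quaternion.imJ_coe, Quaternion.imJ_smul, Quaternion.imK_mul, Quaternion.imK_sub, Quaternion.imK_add, Quaternion.imK_neg, Quaternion.imK_one, Quaternion.imK_star, Quaternion.imK_coe, Quaternion.imK_smul, smul_eq_mul, a0, a1, a2, a3, J0, J1, J2, J3] <;> norm_num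
  have eB : fderiv ℝ (regMob b 1) b (-K) = (4/5 : ℝ) • (-K) := by
    rw [dB.2]
    ext <;> simp only [
      Quaternion.re_mul, Quaternion.re_sub, Quaternion.re_add, Quaternion.re_neg, Quaternion.re_one, Quaternion.re_star, Quaternion.re_coe, Quaternion.re_smul, Quaternion.imI_mul, Quaternion.imI_sub, Quaternion.imI_add, Quaternion.imI_neg, Quaternion.imI_one, Quaternion.imI_star, Quaternion.imI_coe, Quaternion.imI_smul, Quaternion.imJ_mul, Quaternion.imJ_sub, Quaternion.imJ_add, Quaternion.imJ_neg, Quaternion.imJ_one, Quaternion.imJ_star, Quaternion.imJ_coe, Quaternion.imJ_smul, Quaternion.imK_mul, Quaternion.imK_sub, Quaternion.imK_add, Quaternion.imK_neg, Quaternion.imK_one, Quaternion.imK_star, Quaternion.imK_coe, Quaternion.imK_smul, smul_eq_mul, b0, b1, b2, b3, K0, K1, K2, K3] <;> norm_num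
  have mA := hmob a ha 1 (by simp) a ha J
  have mB := hmob b hb 1 (by simp) b hb (-K)
  rw [dA.1, eA] at mA
  rw [dB.1, eB] at mB
  have sc : ∀ (r : ℝ) (d : ℍ), m 0 (r • d) (r • d) = r * (r * m 0 d d) := by
    intro r d
    rw [(hlin 0 h0 _).map_smul, hsym 0 h0, (hlin 0 h0 _).map_smul]; simp
  have r1 := right a ha J
  have r2 := right 0 h0 J
  rw [hab, hJI] at r1
  rw [hJI, zero_mul] at r2
  rw [sc] at mA mB
  have hJ : J ≠ 0 := by
    intro h
    rw [h, Quaternion.imJ_zero] at J2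
    norm_num at J2
  have p := hpos 0 h0 J hJ
  rw [r1, ← mA, r2] at mB
  linarith
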